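/- For every s ≥ 0, every ε ∈ (0, 1/6] and every γ ∈ (0,1) there exists C > 0 with the following property: for all real numbers ξ₀,…,ξ₄, all integers q₀,…,q₄ satisfying the convolution constraint, and every real number N ≥ 1 such that γN ≤ |(ξᵢ,qᵢ)| ≤ N for every i ∈ {1,2,3,4}, |ξ₁| ≤ |ξ₂|≤ |ξ₃| ≤ |ξ₄|, and |ξ₃| ≥ γ|ξ₄|, one has |ξ₀| ⟨(ξ₀,q₀)⟩^s ≤ C · ⟨(ξ₁,q₁)⟩^(s−ε) ⟨(ξ₂,q₂)⟩^(1/2+ε) · |ξ₀|^(1/6) ⟨(ξ₀,q₀)⟩^(−1/3−ε) · |ξ₃|^(1/6) ⟨(ξ₃,q₃)⟩^(1/6+ε) · |ξ₄|^(1/6) ⟨(ξ₄,q₄)⟩^(1/6+ε). -/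

import Mathlib

/-- The weighted norm `|(ξ,q)| = (3ξ² + q²)^(1/2)` for `(ξ,q) ∈ ℝ × ℤ`. -/
noncomputable def wnorm (ξ : ℝ) (q : ℤ) : ℝ := Real.sqrt (3 * ξ ^ 2 + (q : ℝ) ^ 2)

/-- The Japanese bracket `⟨(ξ,q)⟩ = (1 + ξ² + q²)^(1/2)` for `(ξ,q) ∈ ℝ × ℤ`. -/
noncomputable def jb (ξ : ℝ) (q : ℤ) : ℝ := Real.sqrt (1 + ξ ^ 2 + (q : ℝ) ^ 2)

/-- Comparable positive numbers have comparable powers, for exponents of either sign. -/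
theorem rpow_le_rpow_abs_mul_rpow_of_comparable {d N x : ℝ} (hd : 0 < d) (hN : 0 < N)
    (hx : 0 < x) (hNx : N ≤ d * x) (hxN : x ≤ d * N) (a : ℝ) :
    N ^ a ≤ d ^ |a| * x ^ a := by
  rcases le_total 0 a with ha | ha
  · rw [abs_of_nonneg ha, ← Real.mul_rpow hd.le hx.le]
    exact Real.rpow_le_rpow hN.le hNx ha
  · have h := Real.rpow_le_rpow_of_nonpos hx hxN ha
    rw [Real.mul_rpow hd.le hN.le] at h
    rw [abs_of_nonpos ha]
    calc N ^ a = d ^ (-a) * (d ^ a * N ^ a) := by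
          rw [← mul_assoc, ← Real.rpow_add hd]; simp
      _ ≤ d ^ (-a) * x ^ a := by gcongr

theorem sq_wnorm (ξ : ℝ) (q : ℤ) : wnorm ξ q ^ 2 = 3 * ξ ^ 2 + (q : ℝ) ^ 2 :=
  Real.sq_sqrt (by positivity)

theorem sq_jb (ξ : ℝ) (q : ℤ) : jb ξ q ^ 2 = 1 + ξ ^ 2 + (q : ℝ) ^ 2 :=
  Real.sq_sqrt (by positivity)

theorem jb_pos (ξ : ℝ) (q : ℤ) : 0 < jb ξ q :=
  Real.sqrt_pos.2 (by positivity)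

theorem abs_le_jb (ξ : ℝ) (q : ℤ) : |ξ| ≤ jb ξ q :=
  Real.abs_le_sqrt (by nlinarith [sq_nonneg (q : ℝ)])

theorem wnorm_le_two_mul_jb (ξ : ℝ) (q : ℤ) : wnorm ξ q ≤ 2 * jb ξ q :=
  le_of_sq_le_sq (by
    rw [mul_pow, sq_wnorm, sq_jb]
    nlinarith [sq_nonneg ξ, sq_nonneg (q : ℝ)]) (by linarith [jb_pos ξ q])

theorem add_sq_le_of_wnorm_le {ξ N : ℝ} {q : ℤ} (h : wnorm ξ q ≤ N) :
    ξ ^ 2 + (q : ℝ) ^ 2 ≤ N ^ 2 := by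
  have : wnorm ξ q ^ 2 ≤ N ^ 2 := pow_le_pow_left₀ (Real.sqrt_nonneg _) h 2
  rw [sq_wnorm] at this
  nlinarith [sq_nonneg ξ]

theorem jb_le_two_mul {ξ N : ℝ} {q : ℤ} (hN : 1 ≤ N) (h : wnorm ξ q ≤ N) :
    jb ξ q ≤ 2 * N :=
  le_of_sq_le_sq (by
    rw [sq_jb]
    nlinarith [add_sq_le_of_wnorm_le h]) (by linarith)

theorem sq_sum_four_le (a b c d : ℝ) :
    (a + b + c + d) ^ 2 ≤ 4 * (a ^ 2 + b ^ 2 + c ^ 2 + d ^ 2) := by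
  nlinarith [sq_nonneg (a - b), sq_nonneg (a - c), sq_nonneg (a - d), sq_nonneg (b - c),
    sq_nonneg (b - d), sq_nonneg (c - d)]

/-- The bracket of a sum of four frequencies of size at most `N`. -/
theorem jb_sum_four_le {ξ₁ ξ₂ ξ₃ ξ₄ N : ℝ} {q₁ q₂ q₃ q₄ : ℤ} (hN : 1 ≤ N)
    (h₁ : wnorm ξ₁ q₁ ≤ N) (h₂ : wnorm ξ₂ q₂ ≤ N) (h₃ : wnorm ξ₃ q₃ ≤ N)
    (h₄ : wnorm ξ₄ q₄ ≤ N) :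
    jb (ξ₁ + ξ₂ + ξ₃ + ξ₄) (q₁ + q₂ + q₃ + q₄) ≤ 5 * N :=
  le_of_sq_le_sq (by
    rw [sq_jb]
    push_cast
    nlinarith [add_sq_le_of_wnorm_le h₁, add_sq_le_of_wnorm_le h₂, add_sq_le_of_wnorm_le h₃,
      add_sq_le_of_wnorm_le h₄, sq_sum_four_le ξ₁ ξ₂ ξ₃ ξ₄,
      sq_sum_four_le (q₁ : ℝ) q₂ q₃ q₄]) (by linarith)

/-- The frequency bound for abstract sizes `x₀, x₃, x₄` and brackets `J₀, …, J₄`. -/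
theorem mul_rpow_le_of_comparable {s ε d N x₀ x₃ x₄ J₀ J₁ J₂ J₃ J₄ : ℝ} (hs : 0 ≤ s)
    (hε : 0 < ε) (hd : 1 ≤ d) (hN : 1 ≤ N) (hx₀ : 0 ≤ x₀) (hx₃ : 0 ≤ x₃) (hx₄ : 0 ≤ x₄)
    (hJ₀ : 0 < J₀) (hJ₁ : 0 < J₁) (hJ₂ : 0 < J₂) (hJ₃ : 0 < J₃) (hJ₄ : 0 < J₄)
    (hx₀₃ : x₀ ≤ d * x₃) (hx₀₄ : x₀ ≤ d * x₄) (hx₀J₀ : x₀ ≤ J₀) (hJ₀N : J₀ ≤ d * N)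
    (hNJ₁ : N ≤ d * J₁) (hJ₁N : J₁ ≤ d * N) (hNJ₂ : N ≤ d * J₂)
    (hNJ₃ : N ≤ d * J₃) (hNJ₄ : N ≤ d * J₄) :
    x₀ * J₀ ^ s ≤
      d ^ ((1 : ℝ) / 6) * d ^ ((1 : ℝ) / 6) * d ^ (s + 5 / 6 + ε) * d ^ |s - ε| *
        d ^ ((1 : ℝ) / 2 + ε) * d ^ ((1 : ℝ) / 6 + ε) * d ^ ((1 : ℝ) / 6 + ε) *
        (J₁ ^ (s - ε) * J₂ ^ ((1 : ℝ) / 2 + ε) * x₀ ^ ((1 : ℝ) / 6) *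
          J₀ ^ (-(1 : ℝ) / 3 - ε) * x₃ ^ ((1 : ℝ) / 6) * J₃ ^ ((1 : ℝ) / 6 + ε) *
          x₄ ^ ((1 : ℝ) / 6) * J₄ ^ ((1 : ℝ) / 6 + ε)) := by
  have hd0 : 0 < d := by linarith
  have hN0 : 0 < N := by linarith
  have scale : ∀ {a x y : ℝ}, 0 ≤ a → 0 ≤ x → 0 ≤ y → x ≤ d * y → x ^ a ≤ d ^ a * y ^ a := by
    intro a x y ha hx hy h
    rw [← Real.mul_rpow hd0.le hy]
    exact Real.rpow_le_rpow hx h ha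
  have hx₀_split : x₀ = x₀ ^ ((1 : ℝ) / 6) * x₀ ^ ((1 : ℝ) / 6) * x₀ ^ ((1 : ℝ) / 6) *
      x₀ ^ ((1 : ℝ) / 2) := by
    simp only [← Real.rpow_add_of_nonneg hx₀ (show (0 : ℝ) ≤ 1 / 6 by norm_num)
        (show (0 : ℝ) ≤ 1 / 6 by norm_num),
      ← Real.rpow_add_of_nonneg hx₀ (show (0 : ℝ) ≤ 1 / 6 + 1 / 6 by norm_num)
        (show (0 : ℝ) ≤ 1 / 6 by norm_num),
      ← Real.rpow_add_of_nonneg hx₀ (show (0 : ℝ) ≤ 1 / 6 + 1 / 6 + 1 / 6 by norm_num)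
        (show (0 : ℝ) ≤ 1 / 2 by norm_num)]
    norm_num
  have hJ₀_split : J₀ ^ ((1 : ℝ) / 2) * J₀ ^ s =
      J₀ ^ (s + 5 / 6 + ε) * J₀ ^ (-(1 : ℝ) / 3 - ε) := by
    rw [← Real.rpow_add hJ₀, ← Real.rpow_add hJ₀]
    ring_nf
  have hN_split : N ^ (s + 5 / 6 + ε) ≤
      N ^ (s - ε) * N ^ ((1 : ℝ) / 2 + ε) * N ^ ((1 : ℝ) / 6 + ε) * N ^ ((1 : ℝ) / 6 + ε) := by
    simp only [← Real.rpow_add hN0]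
    exact Real.rpow_le_rpow_of_exponent_le hN (by linarith)
  calc x₀ * J₀ ^ s
      = x₀ ^ ((1 : ℝ) / 6) * x₀ ^ ((1 : ℝ) / 6) * x₀ ^ ((1 : ℝ) / 6) *
          (x₀ ^ ((1 : ℝ) / 2) * J₀ ^ s) := by
        conv_lhs => rw [hx₀_split]
        ring
    _ ≤ x₀ ^ ((1 : ℝ) / 6) * (d ^ ((1 : ℝ) / 6) * x₃ ^ ((1 : ℝ) / 6)) *
          (d ^ ((1 : ℝ) / 6) * x₄ ^ ((1 : ℝ) / 6)) * (J₀ ^ ((1 : ℝ) / 2) * J₀ ^ s) := by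
        gcongr
        · exact scale (by norm_num) hx₀ hx₃ hx₀₃
        · exact scale (by norm_num) hx₀ hx₄ hx₀₄
    _ ≤ x₀ ^ ((1 : ℝ) / 6) * (d ^ ((1 : ℝ) / 6) * x₃ ^ ((1 : ℝ) / 6)) *
          (d ^ ((1 : ℝ) / 6) * x₄ ^ ((1 : ℝ) / 6)) *
          (d ^ (s + 5 / 6 + ε) * ((d ^ |s - ε| * J₁ ^ (s - ε)) *
            (d ^ ((1 : ℝ) / 2 + ε) * J₂ ^ ((1 : ℝ) / 2 + ε)) *
            (d ^ ((1 : ℝ) / 6 + ε) * J₃ ^ ((1 : ℝ) / 6 + ε)) *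
            (d ^ ((1 : ℝ) / 6 + ε) * J₄ ^ ((1 : ℝ) / 6 + ε))) * J₀ ^ (-(1 : ℝ) / 3 - ε)) := by
        rw [hJ₀_split]
        gcongr
        refine (scale (by linarith) hJ₀.le hN0.le hJ₀N).trans ?_
        gcongr
        refine hN_split.trans ?_
        gcongr
        · exact rpow_le_rpow_abs_mul_rpow_of_comparable hd0 hN0 hJ₁ hNJ₁ hJ₁N _
        · exact scale (by linarith) hN0.le hJ₂.le hNJ₂
        · exact scale (by linarith) hN0.le hJ₃.le hNJ₃
        · exact scale (by linarith) hN0.le hJ₄.le hNJ₄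
    _ = _ := by ring

theorem stmt_11 (s : ℝ) (hs : 0 ≤ s) (ε : ℝ) (hε : 0 < ε ∧ ε ≤ 1 / 6)
    (γ : ℝ) (hγ : γ ∈ Set.Ioo (0 : ℝ) 1) :
    ∃ C : ℝ, 0 < C ∧
      ∀ (ξ₀ ξ₁ ξ₂ ξ₃ ξ₄ : ℝ) (q₀ q₁ q₂ q₃ q₄ : ℤ) (N : ℝ),
        ξ₀ = ξ₁ + ξ₂ + ξ₃ + ξ₄ → q₀ = q₁ + q₂ + q₃ + q₄ →
        1 ≤ N →
        γ * N ≤ wnorm ξ₁ q₁ → wnorm ξ₁ q₁ ≤ N →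
        γ * N ≤ wnorm ξ₂ q₂ → wnorm ξ₂ q₂ ≤ N →
        γ * N ≤ wnorm ξ₃ q₃ → wnorm ξ₃ q₃ ≤ N →
        γ * N ≤ wnorm ξ₄ q₄ → wnorm ξ₄ q₄ ≤ N →
        |ξ₁| ≤ |ξ₂| → |ξ₂| ≤ |ξ₃| → |ξ₃| ≤ |ξ₄| →
        γ * |ξ₄| ≤ |ξ₃| →
        |ξ₀| * jb ξ₀ q₀ ^ s ≤
          C * (jb ξ₁ q₁ ^ (s - ε) * jb ξ₂ q₂ ^ ((1 : ℝ) / 2 + ε) *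
            |ξ₀| ^ ((1 : ℝ) / 6) * jb ξ₀ q₀ ^ (-(1 : ℝ) / 3 - ε) *
            |ξ₃| ^ ((1 : ℝ) / 6) * jb ξ₃ q₃ ^ ((1 : ℝ) / 6 + ε) *
            |ξ₄| ^ ((1 : ℝ) / 6) * jb ξ₄ q₄ ^ ((1 : ℝ) / 6 + ε)) := by
  obtain ⟨hε₀, -⟩ := hε
  obtain ⟨hγ₀, hγ₁⟩ := hγ
  have hd : 5 ≤ 5 / γ := by rw [le_div_iff₀ hγ₀]; linarith
  have hd0 : 0 < 5 / γ := by linarith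
  refine ⟨(5 / γ) ^ ((1 : ℝ) / 6) * (5 / γ) ^ ((1 : ℝ) / 6) * (5 / γ) ^ (s + 5 / 6 + ε) *
    (5 / γ) ^ |s - ε| * (5 / γ) ^ ((1 : ℝ) / 2 + ε) * (5 / γ) ^ ((1 : ℝ) / 6 + ε) *
    (5 / γ) ^ ((1 : ℝ) / 6 + ε), by positivity, ?_⟩
  rintro ξ₀ ξ₁ ξ₂ ξ₃ ξ₄ q₀ q₁ q₂ q₃ q₄ N rfl rfl hN l₁ u₁ l₂ u₂ l₃ u₃ l₄ u₄ h₁₂ h₂₃ h₃₄ h₄₃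
  have lower : ∀ {ξ : ℝ} {q : ℤ}, γ * N ≤ wnorm ξ q → N ≤ 5 / γ * jb ξ q := by
    intro ξ q h
    rw [div_mul_eq_mul_div, le_div_iff₀ hγ₀]
    linarith [wnorm_le_two_mul_jb ξ q, jb_pos ξ q]
  have hN5 : 5 * N ≤ 5 / γ * N := by gcongr
  have hsum : |ξ₁ + ξ₂ + ξ₃ + ξ₄| ≤ 4 * |ξ₄| := by
    linarith [abs_add_le (ξ₁ + ξ₂ + ξ₃) ξ₄, abs_add_le (ξ₁ + ξ₂) ξ₃, abs_add_le ξ₁ ξ₂]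
  have h₀₃ : |ξ₁ + ξ₂ + ξ₃ + ξ₄| ≤ 5 / γ * |ξ₃| := by
    rw [div_mul_eq_mul_div, le_div_iff₀ hγ₀]
    nlinarith [abs_nonneg ξ₃]
  have h₀₄ : |ξ₁ + ξ₂ + ξ₃ + ξ₄| ≤ 5 / γ * |ξ₄| := by
    nlinarith [abs_nonneg ξ₄]
  exact mul_rpow_le_of_comparable hs hε₀ (by linarith) hN (abs_nonneg _) (abs_nonneg _)
    (abs_nonneg _) (jb_pos _ _) (jb_pos _ _) (jb_pos _ _) (jb_pos _ _) (jb_pos _ _) h₀₃ h₀₄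
    (abs_le_jb _ _) ((jb_sum_four_le hN u₁ u₂ u₃ u₄).trans hN5) (lower l₁)
    ((jb_le_two_mul hN u₁).trans (by linarith)) (lower l₂) (lower l₃) (lower l₄)
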